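/- Let n ≥ 1 and let α be a composition of n. Then ∑_{β} ∏_{i=1}^{ℓ(β)} G(β_i) = α_1!·α_2!⋯α_{ℓ(α)}!, where the sum runs over all compositions β of n that refine α (i.e., D(α) ⊆ D(β)), and G(k) is the number of permutations of Fin k with no global descent. -/

import Mathlib

open scoped Classical

noncomputable section

/-- The descent set of a composition of `n`, as a `Finset (Fin (n-1))`. -/
def descents {n : ℕ} (α : Composition n) : Finset (Fin (n - 1)) :=
  compositionAsSetEquiv n (compositionEquiv n α)

/-- A permutation `π` of `Fin k` has a global descent at position `j` (`1 ≤ j ≤ k−1`)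
if `π a > π b` whenever `a < j ≤ b`. -/
def HasGlobalDescent {k : ℕ} (π : Equiv.Perm (Fin k)) : Prop :=
  ∃ j : ℕ, 1 ≤ j ∧ j ≤ k - 1 ∧ ∀ a b : Fin k, (a : ℕ) < j → j ≤ (b : ℕ) → π b < π a

/-- `G k`: the number of permutations of `Fin k` with no global descent. -/
def G (k : ℕ) : ℕ := Nat.card {π : Equiv.Perm (Fin k) // ¬ HasGlobalDescent π}

end

/-- `π` has a global descent at `j`; this holds vacuously at `j = 0` and for `k ≤ j`. -/
def GlobalDescentAt {k : ℕ} (π : Equiv.Perm (Fin k)) (j : ℕ) : Prop :=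
  ∀ a b : Fin k, (a : ℕ) < j → j ≤ (b : ℕ) → π b < π a

/-- The skew sum of `σ` and `τ`: the pattern `σ` on the first `k` positions, with values above
those of the pattern `τ` on the last `m` positions. -/
def skewSum {k m : ℕ} (σ : Equiv.Perm (Fin k)) (τ : Equiv.Perm (Fin m)) :
    Equiv.Perm (Fin (k + m)) :=
  finSumFinEquiv.symm.trans ((Equiv.sumCongr σ τ).trans ((Equiv.sumComm _ _).trans
    (finSumFinEquiv.trans (finCongr (Nat.add_comm m k)))))

theorem skewSum_castAdd {k m : ℕ} (σ : Equiv.Perm (Fin k)) (τ : Equiv.Perm (Fin m))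
    (i : Fin k) : (skewSum σ τ (Fin.castAdd m i) : ℕ) = m + σ i := by
  simp [skewSum, Nat.add_comm]

theorem skewSum_natAdd {k m : ℕ} (σ : Equiv.Perm (Fin k)) (τ : Equiv.Perm (Fin m))
    (i : Fin m) : (skewSum σ τ (Fin.natAdd k i) : ℕ) = τ i := by
  simp [skewSum]

theorem skewSum_injective {k m : ℕ} {σ σ' : Equiv.Perm (Fin k)} {τ τ' : Equiv.Perm (Fin m)}
    (h : skewSum σ τ = skewSum σ' τ') : σ = σ' ∧ τ = τ' := by
  constructor
  · ext i
    have := congrArg (fun π => (π (Fin.castAdd m i) : ℕ)) h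
    simpa [skewSum_castAdd] using this
  · ext i
    have := congrArg (fun π => (π (Fin.natAdd k i) : ℕ)) h
    simpa [skewSum_natAdd] using this

theorem globalDescentAt_skewSum_iff {k m : ℕ} (σ : Equiv.Perm (Fin k))
    (τ : Equiv.Perm (Fin m)) {j : ℕ} (hj : j ≤ k) :
    GlobalDescentAt (skewSum σ τ) j ↔ GlobalDescentAt σ j := by
  constructor
  · intro h a b ha hb
    have := h (Fin.castAdd m a) (Fin.castAdd m b) (by simpa using ha) (by simpa using hb)
    rw [Fin.lt_def, skewSum_castAdd, skewSum_castAdd] at this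
    exact Fin.lt_def.2 (by omega)
  · intro h a b ha hb
    rw [Fin.lt_def]
    induction a using Fin.addCases with
    | left a =>
      rw [skewSum_castAdd]
      induction b using Fin.addCases with
      | left b =>
        have := Fin.lt_def.1 (h a b (by simpa using ha) (by simpa using hb))
        rw [skewSum_castAdd]
        omega
      | right b =>
        rw [skewSum_natAdd]
        omega
    | right a =>
      rw [Fin.val_natAdd] at ha
      omega

theorem GlobalDescentAt.exists_eq_skewSum {k m : ℕ} {π : Equiv.Perm (Fin (k + m))}
    (h : GlobalDescentAt π k) : ∃ σ : Equiv.Perm (Fin k), ∃ τ : Equiv.Perm (Fin m),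
      skewSum σ τ = π := by
  let ρ : Equiv.Perm (Fin k ⊕ Fin m) :=
    finSumFinEquiv.trans (π.trans ((finCongr (Nat.add_comm m k)).symm.trans
      (finSumFinEquiv.symm.trans (Equiv.sumComm _ _))))
  have hρ : Set.MapsTo ρ (Set.range Sum.inl) (Set.range Sum.inl) := by
    rintro _ ⟨a, rfl⟩
    have hle : m ≤ (π (Fin.castAdd m a) : ℕ) := by
      have hinj : Function.Injective fun i : Fin m =>
          (⟨π (Fin.natAdd k i), Fin.lt_def.1 (h (Fin.castAdd m a) (Fin.natAdd k i)
            (by simp) (by simp))⟩ : Fin (π (Fin.castAdd m a) : ℕ)) := by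
        intro i i' hii
        exact Fin.natAdd_injective _ k (π.injective (Fin.ext (Fin.mk.inj hii)))
      simpa using Fintype.card_le_of_injective _ hinj
    have hlt := (π (Fin.castAdd m a)).isLt
    refine ⟨⟨(π (Fin.castAdd m a) : ℕ) - m, by omega⟩, ?_⟩
    have hval : (finCongr (Nat.add_comm m k)).symm (π (Fin.castAdd m a)) =
        Fin.natAdd m (⟨(π (Fin.castAdd m a) : ℕ) - m, by omega⟩ : Fin k) := by
      ext
      simp
      omega
    simp only [ρ, Equiv.trans_apply, finSumFinEquiv_apply_left, hval,
      finSumFinEquiv_symm_apply_natAdd, Equiv.sumComm_apply, Sum.swap_inr]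
  obtain ⟨⟨σ, τ⟩, hστ⟩ := Equiv.Perm.mem_sumCongrHom_range_of_perm_mapsTo_inl hρ
  refine ⟨σ, τ, ?_⟩
  have hστ' : Equiv.sumCongr σ τ = ρ := hστ
  rw [skewSum, hστ']
  ext i
  simp [ρ]

theorem not_hasGlobalDescent_iff {k : ℕ} (π : Equiv.Perm (Fin k)) :
    ¬ HasGlobalDescent π ↔ ∀ j, 1 ≤ j → j < k → ¬ GlobalDescentAt π j := by
  simp only [HasGlobalDescent, GlobalDescentAt, not_exists, not_and]
  exact forall_congr' fun j => forall_congr' fun h1 =>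
    ⟨fun h hj => h (by omega), fun h hj => h (by omega)⟩

theorem card_first_globalDescentAt (k m : ℕ) :
    Nat.card {π : Equiv.Perm (Fin (k + m)) //
      GlobalDescentAt π k ∧ ∀ j, 1 ≤ j → j < k → ¬ GlobalDescentAt π j} =
      G k * m.factorial := by
  have hG : G k * m.factorial = Nat.card
      ({σ : Equiv.Perm (Fin k) // ¬ HasGlobalDescent σ} × Equiv.Perm (Fin m)) := by
    rw [Nat.card_prod, Nat.card_perm, Nat.card_fin, G]
  rw [hG]
  symm
  refine Nat.card_congr (Equiv.ofBijective (fun p => ⟨skewSum p.1.1 p.2, ?_, ?_⟩) ⟨?_, ?_⟩)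
  · rw [globalDescentAt_skewSum_iff _ _ le_rfl]
    intro a b ha hb
    omega
  · intro j h1 hj
    rw [globalDescentAt_skewSum_iff _ _ hj.le]
    exact (not_hasGlobalDescent_iff _).1 p.1.2 j h1 hj
  · rintro ⟨⟨σ, hσ⟩, τ⟩ ⟨⟨σ', hσ'⟩, τ'⟩ h
    obtain ⟨rfl, rfl⟩ := skewSum_injective (Subtype.ext_iff.1 h)
    rfl
  · rintro ⟨π, hk, hlt⟩
    obtain ⟨σ, τ, rfl⟩ := hk.exists_eq_skewSum
    refine ⟨(⟨σ, (not_hasGlobalDescent_iff σ).2 fun j h1 hj => ?_⟩, τ), rfl⟩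
    rw [← globalDescentAt_skewSum_iff σ τ hj.le]
    exact hlt j h1 hj

theorem factorial_eq_sum_G {n : ℕ} (hn : 1 ≤ n) :
    n.factorial = ∑ k ∈ Finset.Icc 1 n, G k * (n - k).factorial := by
  have hex (π : Equiv.Perm (Fin n)) : ∃ j, 1 ≤ j ∧ GlobalDescentAt π j :=
    ⟨n, hn, fun a b _ hb => absurd b.isLt (by omega)⟩
  have hcard := Finset.card_eq_sum_card_fiberwise (s := (Finset.univ : Finset (Equiv.Perm (Fin n))))
    (t := Finset.Icc 1 n) (f := fun π => Nat.find (hex π)) (fun π _ => by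
      simp only [Finset.coe_Icc, Set.mem_Icc]
      exact ⟨(Nat.find_spec (hex π)).1,
        Nat.find_min' _ ⟨hn, fun a b _ hb => absurd b.isLt (by omega)⟩⟩)
  rw [Finset.card_univ, Fintype.card_perm, Fintype.card_fin] at hcard
  rw [hcard]
  refine Finset.sum_congr rfl fun k hk => ?_
  obtain ⟨hk1, hkn⟩ := Finset.mem_Icc.1 hk
  obtain ⟨m, rfl⟩ := Nat.exists_eq_add_of_le hkn
  rw [Nat.add_sub_cancel_left, ← card_first_globalDescentAt, ← Fintype.card_subtype,
    ← Nat.card_eq_fintype_card]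
  refine Nat.card_congr (Equiv.subtypeEquivRight fun π => ?_)
  simp only [Nat.find_eq_iff, not_and]
  exact ⟨fun h => ⟨h.1.2, fun j h1 hj => h.2 j hj h1⟩,
    fun h => ⟨⟨hk1, h.1⟩, fun j hj h1 => h.2 j h1 hj⟩⟩

/-- The set of sums of prefixes of a list. -/
def prefixSums (l : List ℕ) : Set ℕ := {s | ∃ i, (l.take i).sum = s}

theorem zero_mem_prefixSums (l : List ℕ) : 0 ∈ prefixSums l := ⟨0, by simp⟩

theorem mem_prefixSums_cons {a s : ℕ} {l : List ℕ} :
    s ∈ prefixSums (a :: l) ↔ s = 0 ∨ ∃ t ∈ prefixSums l, s = a + t := by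
  constructor
  · rintro ⟨_ | i, rfl⟩
    · simp
    · exact Or.inr ⟨_, ⟨i, rfl⟩, by simp⟩
  · rintro (rfl | ⟨_, ⟨i, rfl⟩, rfl⟩)
    · exact zero_mem_prefixSums _
    · exact ⟨i + 1, by simp⟩

theorem prefixSums_zero_cons (l : List ℕ) : prefixSums (0 :: l) = prefixSums l := by
  ext s
  rw [mem_prefixSums_cons]
  constructor
  · rintro (rfl | ⟨t, ht, rfl⟩)
    · exact zero_mem_prefixSums l
    · simpa using ht
  · exact fun h => Or.inr ⟨s, h, by simp⟩

theorem prefixSums_cons_subset_cons_iff {a b : ℕ} (ha : 0 < a) (l l' : List ℕ) :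
    prefixSums (a :: l) ⊆ prefixSums (b :: l') ↔
      b ≤ a ∧ prefixSums ((a - b) :: l) ⊆ prefixSums l' := by
  constructor
  · intro h
    have hba : b ≤ a := by
      have := h (mem_prefixSums_cons.2 (Or.inr ⟨0, zero_mem_prefixSums l, rfl⟩))
      rcases mem_prefixSums_cons.1 this with h0 | ⟨t, -, ht⟩ <;> omega
    refine ⟨hba, fun s hs => ?_⟩
    rcases mem_prefixSums_cons.1 hs with rfl | ⟨t, ht, rfl⟩
    · exact zero_mem_prefixSums l'
    · rcases mem_prefixSums_cons.1 (h (mem_prefixSums_cons.2 (Or.inr ⟨t, ht, rfl⟩))) with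
        h0 | ⟨u, hu, h0⟩
      · omega
      · rwa [show a - b + t = u by omega]
  · rintro ⟨hba, h⟩ s hs
    rcases mem_prefixSums_cons.1 hs with rfl | ⟨t, ht, rfl⟩
    · exact zero_mem_prefixSums _
    · exact mem_prefixSums_cons.2 (Or.inr ⟨a - b + t,
        h (mem_prefixSums_cons.2 (Or.inr ⟨t, ht, rfl⟩)), by omega⟩)

theorem Composition.mem_boundaries_iff {n : ℕ} (α : Composition n) (s : Fin (n + 1)) :
    s ∈ α.boundaries ↔ (s : ℕ) ∈ prefixSums α.blocks := by
  simp only [Composition.boundaries, Finset.mem_map, Finset.mem_univ, true_and, prefixSums,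
    Set.mem_ofPred_eq]
  constructor
  · rintro ⟨i, rfl⟩
    exact ⟨i, rfl⟩
  · rintro ⟨i, hi⟩
    rcases le_total i α.length with h | h
    · exact ⟨⟨i, by omega⟩, Fin.ext hi⟩
    · refine ⟨Fin.last _, Fin.ext ?_⟩
      rw [← hi, List.take_of_length_le h, α.blocks_sum]
      exact congrArg Fin.val α.boundary_last

theorem mem_descents_iff {n : ℕ} (α : Composition n) (i : Fin (n - 1)) :
    i ∈ descents α ↔ 1 + (i : ℕ) ∈ prefixSums α.blocks := by
  rw [← α.mem_boundaries_iff ⟨1 + i, by omega⟩]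
  simp [descents, compositionAsSetEquiv, compositionEquiv, Composition.toCompositionAsSet]

theorem Composition.mem_prefixSums_le {n : ℕ} (α : Composition n) {s : ℕ}
    (hs : s ∈ prefixSums α.blocks) : s ≤ n := by
  obtain ⟨i, rfl⟩ := hs
  exact α.sizeUpTo_le i

theorem Composition.self_mem_prefixSums {n : ℕ} (α : Composition n) :
    n ∈ prefixSums α.blocks :=
  ⟨α.length, α.sizeUpTo_length⟩

theorem descents_subset_iff {n : ℕ} (α β : Composition n) :
    descents α ⊆ descents β ↔ prefixSums α.blocks ⊆ prefixSums β.blocks := by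
  constructor
  · intro h s hs
    rcases Nat.eq_zero_or_pos s with rfl | h0
    · exact zero_mem_prefixSums _
    rcases (α.mem_prefixSums_le hs).eq_or_lt with rfl | hlt
    · exact β.self_mem_prefixSums
    have hs1 : 1 + (s - 1) = s := by omega
    have := (mem_descents_iff β _).1 (h ((mem_descents_iff α ⟨s - 1, by omega⟩).2
      (by simpa only [hs1] using hs)))
    simpa only [hs1] using this
  · intro h i hi
    rw [mem_descents_iff] at hi ⊢
    exact h hi

/-- The composition of `n` with first block `b`, continued by a composition of `n - b`. -/
def Composition.consBlock {n b : ℕ} (hb : b ∈ Finset.Icc 1 n) (β : Composition (n - b)) :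
    Composition n where
  blocks := b :: β.blocks
  blocks_pos := by
    rintro i hi
    rcases List.mem_cons.1 hi with rfl | hi
    · exact (Finset.mem_Icc.1 hb).1
    · exact β.blocks_pos hi
  blocks_sum := by
    have := (Finset.mem_Icc.1 hb).2
    rw [List.sum_cons, β.blocks_sum]
    omega

theorem Composition.sum_eq_sum_consBlock {M : Type*} [AddCommMonoid M] {n : ℕ} (hn : 1 ≤ n)
    (f : List ℕ → M) : ∑ β : Composition n, f β.blocks =
      ∑ b ∈ Finset.Icc 1 n, ∑ β : Composition (n - b), f (b :: β.blocks) := by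
  rw [Finset.sum_sigma']
  symm
  refine Finset.sum_bij (fun p hp => Composition.consBlock (Finset.mem_sigma.1 hp).1 p.2)
    (fun _ _ => Finset.mem_univ _) ?_ ?_ (fun _ _ => rfl)
  · rintro ⟨b, β⟩ hp ⟨b', β'⟩ hp' h
    obtain ⟨rfl, h2⟩ := List.cons.inj (congrArg Composition.blocks h)
    obtain rfl := Composition.ext h2
    rfl
  · rintro ⟨_ | ⟨b, l⟩, hpos, hsum⟩ -
    · simp at hsum
      omega
    · have hb := hpos (List.mem_cons_self)
      rw [List.sum_cons] at hsum
      refine ⟨⟨b, ⟨l, fun hi => hpos (List.mem_cons_of_mem _ hi), by omega⟩⟩, ?_, rfl⟩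
      simp
      omega

theorem sum_prod_G_of_prefixSums_subset (n : ℕ) (l : List ℕ) (hl : l.sum = n) :
    (∑ β : Composition n, if prefixSums l ⊆ prefixSums β.blocks
      then (β.blocks.map G).prod else 0) = (l.map Nat.factorial).prod := by
  induction n using Nat.strong_induction_on generalizing l with
  | _ n ihn =>
  induction l with
  | nil =>
    obtain rfl : 0 = n := by simpa using hl
    have hb (β : Composition 0) : β.blocks = [] := β.blocks_eq_nil.2 rfl
    simp [hb, composition_card]
  | cons a l ihl =>
    rcases Nat.eq_zero_or_pos a with rfl | ha
    · rw [prefixSums_zero_cons, ihl (by simpa using hl)]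
      simp
    rw [List.sum_cons] at hl
    rw [Composition.sum_eq_sum_consBlock (by omega) fun s =>
        if prefixSums (a :: l) ⊆ prefixSums s then (s.map G).prod else 0]
    have hterm : ∀ b ∈ Finset.Icc 1 n, (∑ β : Composition (n - b),
        if prefixSums (a :: l) ⊆ prefixSums (b :: β.blocks)
          then ((b :: β.blocks).map G).prod else 0) =
        if b ≤ a then G b * (a - b).factorial * (l.map Nat.factorial).prod else 0 := by
      intro b hb
      obtain ⟨hb1, hbn⟩ := Finset.mem_Icc.1 hb
      simp only [prefixSums_cons_subset_cons_iff ha]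
      split_ifs with hba
      · have := ihn (n - b) (by omega) ((a - b) :: l) (by rw [List.sum_cons]; omega)
        rw [List.map_cons, List.prod_cons] at this
        rw [mul_assoc, ← this, Finset.mul_sum]
        refine Finset.sum_congr rfl fun β _ => ?_
        simp [hba]
      · simp [hba]
    rw [Finset.sum_congr rfl hterm, ← Finset.sum_filter, List.map_cons, List.prod_cons,
      factorial_eq_sum_G ha, Finset.sum_mul]
    refine Finset.sum_congr ?_ fun _ _ => rfl
    ext b
    simp
    omega

theorem Composition.prod_blocksFun {M : Type*} [CommMonoid M] {n : ℕ} (β : Composition n)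
    (f : ℕ → M) : ∏ i : Fin β.length, f (β.blocksFun i) = (β.blocks.map f).prod := by
  rw [← β.ofFn_blocksFun, List.map_ofFn, List.prod_ofFn]
  rfl

/-- For a composition `α` of `n`, `∑_{β refines α} ∏_i G(β_i) = α_1! α_2! ⋯ α_{ℓ(α)}!`,
where `β` refines `α` iff `D(α) ⊆ D(β)`. -/
theorem stmt7 (n : ℕ) (hn : 1 ≤ n) (α : Composition n) :
    ∑ β ∈ Finset.univ.filter (fun β : Composition n => descents α ⊆ descents β),
        ∏ i : Fin β.length, G (β.blocksFun i) =
      ∏ i : Fin α.length, (α.blocksFun i).factorial := by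
  rw [α.prod_blocksFun, ← sum_prod_G_of_prefixSums_subset n α.blocks α.blocks_sum,
    Finset.sum_filter]
  simp only [descents_subset_iff, Composition.prod_blocksFun]
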